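/- Let n, d be positive integers with dn even and fix a constant γ > 0. For every i with 0 ≤ i ≤ i1 − 1 and every pairing P ∈ S_i, the number of class A switchings producing P satisfies b_A(P) ≥ M2² − M2·(d−1)·(16i + 3d² + d + 6). -/

import Mathlib

/-!
Formalization of the pairing model of random `d`-regular (multi)graphs and of the
switchings used in the uniform sampler *REG* of Gao and Wormald,
"Uniform generation of random regular graphs".

Bins are elements of `Fin n`; each bin contains `d` points, so points are
elements of `Fin n × Fin d`.  A pairing is a perfect matching of the points,
modelled as a fixed-point-free involution on the points: the pairs of the
pairing are the orbits `{x, P.f x}`.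
-/

namespace Reg

abbrev Point (n d : ℕ) := Fin n × Fin d

/-- A pairing: a perfect matching of the `d * n` points, encoded as a
fixed-point-free involution.  The pairs are the 2-element sets `{x, f x}`. -/
structure Pairing (n d : ℕ) where
  f : Point n d → Point n d
  invol : ∀ x, f (f x) = x
  nofix : ∀ x, f x ≠ x

instance {n d : ℕ} : Finite (Pairing n d) :=
  Finite.of_injective (fun P => P.f) fun P Q h => by
    cases P; cases Q; congr

variable {n d : ℕ}

/-- The number of pairs of `P` with one point in bin `u` and one point in bin `v`
(for distinct bins `u ≠ v` this is the multiplicity of the edge `uv`). -/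
def mult (P : Pairing n d) (u v : Fin n) : ℕ :=
  (Finset.univ.filter fun a : Point n d => a.1 = u ∧ (P.f a).1 = v).card

/-- Two bins are adjacent if some pair of the pairing joins them. -/
def Adj (P : Pairing n d) (u v : Fin n) : Prop := u ≠ v ∧ 1 ≤ mult P u v

/-- The number of loops of `P` (pairs whose two points lie in the same bin). -/
def numLoops (P : Pairing n d) : ℕ :=
  (Finset.univ.filter fun a : Point n d => (P.f a).1 = a.1).card / 2

/-- The number of loops of `P` lying in bin `u`. -/
def loopsAt (P : Pairing n d) (u : Fin n) : ℕ :=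
  (Finset.univ.filter fun a : Point n d => a.1 = u ∧ (P.f a).1 = u).card / 2

/-- The number of (unordered) pairs of distinct bins joined by exactly `k` pairs of `P`,
i.e. the number of edges of multiplicity exactly `k`. -/
def edgesWithMult (P : Pairing n d) (k : ℕ) : ℕ :=
  (Finset.univ.filter fun q : Fin n × Fin n => q.1 < q.2 ∧ mult P q.1 q.2 = k).card

/-- `M1 = dn` as a real number. -/
noncomputable def M1R (n d : ℕ) : ℝ := (d : ℝ) * n

/-- `M2 = n d (d-1)` as a real number. -/
noncomputable def M2R (n d : ℕ) : ℝ := (n : ℝ) * d * ((d : ℝ) - 1)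

/-- `M3 = n d (d-1) (d-2)` as a real number. -/
noncomputable def M3R (n d : ℕ) : ℝ := (n : ℝ) * d * ((d : ℝ) - 1) * ((d : ℝ) - 2)

/-- `i1 = ⌊(1+γ)(d-1)²/4⌋`. -/
noncomputable def i1Nat (d : ℕ) (γ : ℝ) : ℕ := (⌊(1 + γ) * ((d : ℝ) - 1) ^ 2 / 4⌋).toNat

/-- The stratum `S_i` of the double-edge reduction phase: pairings with no loops,
every edge of multiplicity at most 2, and exactly `i` double edges. -/
def SD (n d i : ℕ) : Set (Pairing n d) :=
  {P | numLoops P = 0 ∧ (∀ u v : Fin n, u ≠ v → mult P u v ≤ 2) ∧ edgesWithMult P 2 = i}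

/-- `Φ1 = ⋃_{0 ≤ i ≤ m} S_i`. -/
def Phi1 (n d m : ℕ) : Set (Pairing n d) := {P | ∃ i ≤ m, P ∈ SD n d i}

/-- The labelled data (points 1–8) of a d-switching. -/
structure DSwitch (n d : ℕ) where
  p1 : Point n d
  p2 : Point n d
  p3 : Point n d
  p4 : Point n d
  p5 : Point n d
  p6 : Point n d
  p7 : Point n d
  p8 : Point n d

/-- The four target bin-pairs `u1u2, u1u3, v1v2, v1v3` of a d-switching. -/
def targets (s : DSwitch n d) : List (Fin n × Fin n) :=
  [(s.p1.1, s.p5.1), (s.p1.1, s.p7.1), (s.p2.1, s.p6.1), (s.p2.1, s.p8.1)]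

/-- `s` is a valid d-switching on `P`. -/
def IsDSwitch (P : Pairing n d) (s : DSwitch n d) : Prop :=
  P.f s.p1 = s.p2 ∧ P.f s.p3 = s.p4 ∧ P.f s.p5 = s.p6 ∧ P.f s.p7 = s.p8 ∧
  s.p1.1 = s.p3.1 ∧ s.p2.1 = s.p4.1 ∧ s.p1 ≠ s.p3 ∧
  mult P s.p1.1 s.p2.1 = 2 ∧ mult P s.p5.1 s.p6.1 = 1 ∧ mult P s.p7.1 s.p8.1 = 1 ∧
  [s.p1.1, s.p2.1, s.p5.1, s.p6.1, s.p7.1, s.p8.1].Pairwise (· ≠ ·)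

/-- The number of target bin-pairs of `s` joined by at least one pair of `P`. -/
def joinedCount (P : Pairing n d) (s : DSwitch n d) : ℕ :=
  (targets s).countP fun t => decide (1 ≤ mult P t.1 t.2)

/-- A type I switching: a d-switching creating at most one new double edge. -/
def IsTypeI (P : Pairing n d) (s : DSwitch n d) : Prop :=
  IsDSwitch P s ∧ (∀ t ∈ targets s, mult P t.1 t.2 ≤ 1) ∧ joinedCount P s ≤ 1

/-- A type I switching of class A: it creates no new double edge. -/
def IsTypeIA (P : Pairing n d) (s : DSwitch n d) : Prop := IsTypeI P s ∧ joinedCount P s = 0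

/-- A type I switching of class B: it creates exactly one new double edge. -/
def IsTypeIB (P : Pairing n d) (s : DSwitch n d) : Prop := IsTypeI P s ∧ joinedCount P s = 1

/-- The labelled data (points 1–12) of a type II switching. -/
structure DSwitch2 (n d : ℕ) extends DSwitch n d where
  p9 : Point n d
  p10 : Point n d
  p11 : Point n d
  p12 : Point n d

/-- A type II switching: a d-switching creating exactly two new double edges, both
incident with `u1` or both incident with `v1`, together with the labelling
`{9,10}, {11,12}` (with 9 and 12 in `u1`, resp. `v1`) of the two existing pairs
joining the two joined target bin-pairs. -/
def IsTypeII (P : Pairing n d) (s : DSwitch2 n d) : Prop :=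
  IsDSwitch P s.toDSwitch ∧ (∀ t ∈ targets s.toDSwitch, mult P t.1 t.2 ≤ 1) ∧
  P.f s.p9 = s.p10 ∧ P.f s.p11 = s.p12 ∧
  ((s.p9.1 = s.p1.1 ∧ s.p12.1 = s.p1.1 ∧
      ((s.p10.1 = s.p5.1 ∧ s.p11.1 = s.p7.1) ∨ (s.p10.1 = s.p7.1 ∧ s.p11.1 = s.p5.1)) ∧
      mult P s.p1.1 s.p5.1 = 1 ∧ mult P s.p1.1 s.p7.1 = 1 ∧
      mult P s.p2.1 s.p6.1 = 0 ∧ mult P s.p2.1 s.p8.1 = 0) ∨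
    (s.p9.1 = s.p2.1 ∧ s.p12.1 = s.p2.1 ∧
      ((s.p10.1 = s.p6.1 ∧ s.p11.1 = s.p8.1) ∨ (s.p10.1 = s.p8.1 ∧ s.p11.1 = s.p6.1)) ∧
      mult P s.p2.1 s.p6.1 = 1 ∧ mult P s.p2.1 s.p8.1 = 1 ∧
      mult P s.p1.1 s.p5.1 = 0 ∧ mult P s.p1.1 s.p7.1 = 0))

/-- Conjugating a pairing by a permutation of the points: the pairs of
`conj P τ` are the images under `τ` of the pairs of `P`. -/
def conj (P : Pairing n d) (τ : Equiv.Perm (Point n d)) : Pairing n d where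
  f := fun x => τ (P.f (τ.symm x))
  invol := by intro x; simp [P.invol]
  nofix := by
    intro x h
    refine P.nofix (τ.symm x) ?_
    have h3 := congrArg τ.symm h
    simpa using h3

/-- The permutation performing a d-switching: it replaces the pairs
`{1,2},{3,4},{5,6},{7,8}` by `{1,5},{3,7},{2,6},{4,8}`. -/
def dtau (s : DSwitch n d) : Equiv.Perm (Point n d) :=
  (Equiv.swap s.p4 s.p7).trans (Equiv.swap s.p2 s.p5)

/-- The pairing resulting from performing a d-switching. -/
def dResult (P : Pairing n d) (s : DSwitch n d) : Pairing n d := conj P (dtau s)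

/-- `f_I(P)`: the number of type I switchings on `P`. -/
noncomputable def fI (P : Pairing n d) : ℕ := Nat.card {s : DSwitch n d // IsTypeI P s}

/-- `f_II(P)`: the number of type II switchings on `P`. -/
noncomputable def fII (P : Pairing n d) : ℕ := Nat.card {s : DSwitch2 n d // IsTypeII P s}

/-- `b_A(P)`: the number of class A switchings from pairings in `Φ1` producing `P`. -/
noncomputable def bA (m : ℕ) (P : Pairing n d) : ℕ :=
  Nat.card {q : Pairing n d × DSwitch n d //
    q.1 ∈ Phi1 n d m ∧ IsTypeIA q.1 q.2 ∧ dResult q.1 q.2 = P}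

/-- `b_B(P)`: the number of class B switchings (of type I or type II) from
pairings in `Φ1` producing `P`. -/
noncomputable def bB (m : ℕ) (P : Pairing n d) : ℕ :=
  Nat.card {q : Pairing n d × DSwitch n d //
    q.1 ∈ Phi1 n d m ∧ IsTypeIB q.1 q.2 ∧ dResult q.1 q.2 = P} +
  Nat.card {q : Pairing n d × DSwitch2 n d //
    q.1 ∈ Phi1 n d m ∧ IsTypeII q.1 q.2 ∧ dResult q.1 q.2.toDSwitch = P}

/-- `B_D = ⌊(1+γ)(d-1)²/4⌋`. -/
noncomputable def BD (d : ℕ) (γ : ℝ) : ℕ := i1Nat d γ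

/-- `B_L = max(⌈log dn⌉, 4d)`. -/
noncomputable def BL (n d : ℕ) : ℕ := max (⌈Real.log ((d : ℝ) * n)⌉.toNat) (4 * d)

/-- `B_T = max(⌈log dn⌉, ⌈d³/n⌉)`. -/
noncomputable def BT (n d : ℕ) : ℕ :=
  max (⌈Real.log ((d : ℝ) * n)⌉.toNat) (⌈(d : ℝ) ^ 3 / (n : ℝ)⌉.toNat)

/-- The set `A` of pairings that are not initially rejected:
`D(P) ≤ B_D`, `L(P) ≤ B_L` and `T(P) ≤ B_T`. -/
def AccSet (n d : ℕ) (γ : ℝ) : Set (Pairing n d) :=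
  {P | edgesWithMult P 2 ≤ BD d γ ∧ numLoops P ≤ BL n d ∧ edgesWithMult P 3 ≤ BT n d}

/-- The stratum `S^L_i` of the loop reduction phase. -/
def SL (n d : ℕ) (γ : ℝ) (i : ℕ) : Set (Pairing n d) :=
  {P | numLoops P = i ∧ (∀ u : Fin n, loopsAt P u ≤ 1) ∧
    edgesWithMult P 2 ≤ BD d γ ∧ edgesWithMult P 3 ≤ BT n d ∧
    ∀ u v : Fin n, u ≠ v → mult P u v ≤ 3}

/-- The labelled data (points 1–6) of a type L switching. -/
structure LSwitch (n d : ℕ) where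
  q1 : Point n d
  q2 : Point n d
  q3 : Point n d
  q4 : Point n d
  q5 : Point n d
  q6 : Point n d

/-- `s` is a valid type L switching on `P`. -/
def IsLSwitch (P : Pairing n d) (s : LSwitch n d) : Prop :=
  P.f s.q1 = s.q2 ∧ s.q1.1 = s.q2.1 ∧
  P.f s.q3 = s.q4 ∧ P.f s.q5 = s.q6 ∧
  mult P s.q3.1 s.q4.1 = 1 ∧ mult P s.q5.1 s.q6.1 = 1 ∧
  [s.q1.1, s.q3.1, s.q4.1, s.q5.1, s.q6.1].Pairwise (· ≠ ·) ∧
  mult P s.q1.1 s.q3.1 = 0 ∧ mult P s.q1.1 s.q5.1 = 0 ∧ mult P s.q4.1 s.q6.1 = 0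

/-- The permutation performing a type L switching: it replaces the pairs
`{1,2},{3,4},{5,6}` by `{1,3},{2,5},{4,6}`. -/
def ltau (s : LSwitch n d) : Equiv.Perm (Point n d) :=
  (Equiv.swap s.q4 s.q5).trans (Equiv.swap s.q2 s.q3)

/-- The pairing resulting from performing a type L switching. -/
def lResult (P : Pairing n d) (s : LSwitch n d) : Pairing n d := conj P (ltau s)

/-- `f_L(P)`: the number of type L switchings on `P`. -/
noncomputable def fL (P : Pairing n d) : ℕ := Nat.card {s : LSwitch n d // IsLSwitch P s}

/-- `b_A^L(P)`: the number of type L switchings from pairings in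
`⋃_{0 ≤ j ≤ B_L} S^L_j` producing `P`. -/
noncomputable def bAL (γ : ℝ) (P : Pairing n d) : ℕ :=
  Nat.card {q : Pairing n d × LSwitch n d //
    (∃ j ≤ BL n d, q.1 ∈ SL n d γ j) ∧ IsLSwitch q.1 q.2 ∧ lResult q.1 q.2 = P}

/-- The stratum `S^T_i` of the triple-edge reduction phase. -/
def ST (n d : ℕ) (γ : ℝ) (i : ℕ) : Set (Pairing n d) :=
  {P | numLoops P = 0 ∧ edgesWithMult P 3 = i ∧ edgesWithMult P 2 ≤ BD d γ ∧
    ∀ u v : Fin n, u ≠ v → mult P u v ≤ 3}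

/-- The labelled data (points 1–12) of a type T switching. -/
structure TSwitch (n d : ℕ) where
  r1 : Point n d
  r2 : Point n d
  r3 : Point n d
  r4 : Point n d
  r5 : Point n d
  r6 : Point n d
  r7 : Point n d
  r8 : Point n d
  r9 : Point n d
  r10 : Point n d
  r11 : Point n d
  r12 : Point n d

/-- `s` is a valid type T switching on `P`. -/
def IsTSwitch (P : Pairing n d) (s : TSwitch n d) : Prop :=
  P.f s.r1 = s.r2 ∧ P.f s.r3 = s.r4 ∧ P.f s.r5 = s.r6 ∧
  P.f s.r7 = s.r8 ∧ P.f s.r9 = s.r10 ∧ P.f s.r11 = s.r12 ∧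
  s.r1.1 = s.r3.1 ∧ s.r3.1 = s.r5.1 ∧ s.r2.1 = s.r4.1 ∧ s.r4.1 = s.r6.1 ∧
  s.r1 ≠ s.r3 ∧ s.r3 ≠ s.r5 ∧ s.r1 ≠ s.r5 ∧
  mult P s.r1.1 s.r2.1 = 3 ∧
  mult P s.r7.1 s.r8.1 = 1 ∧ mult P s.r9.1 s.r10.1 = 1 ∧ mult P s.r11.1 s.r12.1 = 1 ∧
  [s.r1.1, s.r2.1, s.r7.1, s.r8.1, s.r9.1, s.r10.1, s.r11.1, s.r12.1].Pairwise (· ≠ ·) ∧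
  mult P s.r1.1 s.r7.1 = 0 ∧ mult P s.r1.1 s.r9.1 = 0 ∧ mult P s.r1.1 s.r11.1 = 0 ∧
  mult P s.r2.1 s.r8.1 = 0 ∧ mult P s.r2.1 s.r10.1 = 0 ∧ mult P s.r2.1 s.r12.1 = 0

/-- The permutation performing a type T switching: it replaces the pairs
`{1,2},{3,4},{5,6},{7,8},{9,10},{11,12}` by `{1,7},{2,8},{3,9},{4,10},{5,11},{6,12}`. -/
def ttau (s : TSwitch n d) : Equiv.Perm (Point n d) :=
  ((Equiv.swap s.r2 s.r7).trans (Equiv.swap s.r4 s.r9)).trans (Equiv.swap s.r6 s.r11)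

/-- The pairing resulting from performing a type T switching. -/
def tResult (P : Pairing n d) (s : TSwitch n d) : Pairing n d := conj P (ttau s)

/-- `f_T(P)`: the number of type T switchings on `P`. -/
noncomputable def fT (P : Pairing n d) : ℕ := Nat.card {s : TSwitch n d // IsTSwitch P s}

/-- `b_A^T(P)`: the number of type T switchings from pairings in
`⋃_{0 ≤ j ≤ B_T} S^T_j` producing `P`. -/
noncomputable def bAT (γ : ℝ) (P : Pairing n d) : ℕ :=
  Nat.card {q : Pairing n d × TSwitch n d //
    (∃ j ≤ BT n d, q.1 ∈ ST n d γ j) ∧ IsTSwitch q.1 q.2 ∧ tResult q.1 q.2 = P}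

/-- The endpoints of the pair of `P` containing the point `a` lie in bins
`w1, w2` such that `u, v, w1, w2` are four distinct bins, `w1` is adjacent to `u`
and `w2` is adjacent to `v`. -/
def GoodPair (u v : Fin n) (P : Pairing n d) (a : Point n d) : Prop :=
  ∃ w1 w2 : Fin n,
    ((w1 = a.1 ∧ w2 = (P.f a).1) ∨ (w1 = (P.f a).1 ∧ w2 = a.1)) ∧
    [u, v, w1, w2].Pairwise (· ≠ ·) ∧ Adj P w1 u ∧ Adj P w2 v

/-- Four times the number of unordered pairs `{e, e'}` of distinct pairs of `P`
joining the same two distinct bins: ordered pairs of points `(a, b)` lying in a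
common bin whose mates also lie in a common (different) bin. -/
def parallelOrdered (P : Pairing n d) : ℕ :=
  (Finset.univ.filter fun q : Point n d × Point n d =>
    q.1.1 = q.2.1 ∧ (P.f q.1).1 = (P.f q.2).1 ∧ q.1.1 ≠ (P.f q.1).1 ∧ q.1 ≠ q.2).card

/-- Twice the number of unordered pairs of two distinct double edges of `P`
sharing a common bin (double edges being recorded as ordered bin-pairs `(u,v)`
with `u < v`). -/
def doubleSharedOrdered (P : Pairing n d) : ℕ :=
  (Finset.univ.filter fun q : (Fin n × Fin n) × (Fin n × Fin n) =>
    q.1.1 < q.1.2 ∧ q.2.1 < q.2.2 ∧ mult P q.1.1 q.1.2 = 2 ∧ mult P q.2.1 q.2.2 = 2 ∧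
    q.1 ≠ q.2 ∧
    (q.1.1 = q.2.1 ∨ q.1.1 = q.2.2 ∨ q.1.2 = q.2.1 ∨ q.1.2 = q.2.2)).card

/-- `m̄_I(i) = 4 i (M1 - 4i)²`. -/
noncomputable def mbarIp (nR dR : ℝ) (i : ℕ) : ℝ := 4 * i * (dR * nR - 4 * i) ^ 2

/-- `m̄_II(i) = 16 i (d-1)² (d-2) (d-3)`. -/
noncomputable def mbarIIp (dR : ℝ) (i : ℕ) : ℝ :=
  16 * i * (dR - 1) ^ 2 * (dR - 2) * (dR - 3)

/-- `m̲_A(i) = M2² - M2 (d-1) (16 i + 3d² + d + 6)`. -/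
noncomputable def mAp (nR dR : ℝ) (i : ℕ) : ℝ :=
  (nR * dR * (dR - 1)) ^ 2 - nR * dR * (dR - 1) * (dR - 1) * (16 * i + 3 * dR ^ 2 + dR + 6)

/-- `m̲_B(i) = 16 i (d-2) M2 - 16 i d (8 i d + 9 d² + 3 d³)`. -/
noncomputable def mBp (nR dR : ℝ) (i : ℕ) : ℝ :=
  16 * i * (dR - 2) * (nR * dR * (dR - 1)) - 16 * i * dR * (8 * i * dR + 9 * dR ^ 2 + 3 * dR ^ 3)

/-- The system of equations (18)–(21) of the paper determining the type
probabilities `ρ_I, ρ_II` and the (scaled) expected numbers of visits `x_j`,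
together with the positivity requirement on the `x_j`. -/
def Sys (nR dR ε : ℝ) (m : ℕ) (x ρI ρII : ℕ → ℝ) : Prop :=
  (∀ j ≤ m, 0 < x j) ∧
  (∀ i : ℕ, 1 ≤ i → i ≤ m → ρI i = 1 - ε) ∧
  ρI 0 = 0 ∧ ρII 0 = 0 ∧ ρII m = 0 ∧
  (∀ j : ℕ, 1 ≤ j → j + 1 ≤ m →
    x j = 1 + x (j + 1) * ρI (j + 1) * mAp nR dR j / mbarIp nR dR (j + 1)
        + x j * ρI j * mBp nR dR j / mbarIp nR dR j) ∧
  (x m = 1 + x m * ρI m * mBp nR dR m / mbarIp nR dR m) ∧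
  (x 0 = 1 + x 1 * ρI 1 * mAp nR dR 0 / mbarIp nR dR 1) ∧
  (∀ j : ℕ, j + 1 ≤ m →
    ρII j = ρI (j + 1) * (x (j + 1) / x j) * (mbarIIp dR j / mbarIp nR dR (j + 1)))

/-- The explicit unique positive root `x(d)`. -/
noncomputable def xd (dR : ℝ) : ℝ :=
  (7 / 2) * dR - 7 / 2 + 5 / dR +
    (1 / (2 * dR)) * Real.sqrt (65 * dR ^ 4 - 210 * dR ^ 3 + 461 * dR ^ 2 - 412 * dR + 196)

instance : Finite (DSwitch n d) :=
  Finite.of_injective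
    (fun s => (s.p1, s.p2, s.p3, s.p4, s.p5, s.p6, s.p7, s.p8)) fun s t h => by
      cases s; cases t; simpa using h

/-! ### Elementary facts about multiplicities -/

theorem mult_comm (P : Pairing n d) (u v : Fin n) : mult P u v = mult P v u := by
  unfold mult
  refine Finset.card_bij' (fun a _ => P.f a) (fun a _ => P.f a) ?_ ?_ ?_ ?_ <;>
    simp +contextual [P.invol]

theorem one_le_mult (P : Pairing n d) (a : Point n d) : 1 ≤ mult P a.1 (P.f a).1 :=
  Finset.card_pos.mpr ⟨a, by simp⟩

theorem two_le_mult (P : Pairing n d) {a b : Point n d} (hab : a ≠ b) (h1 : a.1 = b.1)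
    (h2 : (P.f a).1 = (P.f b).1) : 2 ≤ mult P a.1 (P.f a).1 := by
  rw [← Finset.card_pair hab]
  exact Finset.card_le_card fun x hx => by
    rcases Finset.mem_insert.mp hx with rfl | hx
    · simp
    · rw [Finset.mem_singleton.mp hx]; simp [h1, h2]

theorem numLoops_eq_zero_iff (P : Pairing n d) :
    numLoops P = 0 ↔ ∀ a, (P.f a).1 ≠ a.1 := by
  constructor
  · intro h a ha
    have h2 : ({a, P.f a} : Finset (Point n d)).card ≤
        (Finset.univ.filter fun a : Point n d => (P.f a).1 = a.1).card :=
      Finset.card_le_card fun x hx => by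
        rcases Finset.mem_insert.mp hx with rfl | hx
        · simpa using ha
        · rw [Finset.mem_singleton.mp hx]; simp [P.invol, ha]
    rw [Finset.card_pair (P.nofix a).symm] at h2
    unfold numLoops at h
    omega
  · intro h
    simp [numLoops, h]

/-- Changing a pairing on a duplicate-free list of points changes multiplicities only through
the points of that list. -/
theorem mult_add_sum_eq (P Q : Pairing n d) (l : List (Point n d)) (hl : l.Nodup)
    (h : ∀ x ∉ l, Q.f x = P.f x) (u v : Fin n) :
    mult Q u v + (l.map fun a => if a.1 = u ∧ (P.f a).1 = v then 1 else 0).sum =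
      mult P u v + (l.map fun a => if a.1 = u ∧ (Q.f a).1 = v then 1 else 0).sum := by
  have split (R : Pairing n d) : mult R u v =
      (l.map fun a => if a.1 = u ∧ (R.f a).1 = v then 1 else 0).sum +
        ∑ a ∈ l.toFinsetᶜ, if a.1 = u ∧ (R.f a).1 = v then 1 else 0 := by
    rw [← List.sum_toFinset _ hl, Finset.sum_add_sum_compl, mult, Finset.card_filter]
  have hc : (∑ a ∈ l.toFinsetᶜ, if a.1 = u ∧ (Q.f a).1 = v then 1 else 0) =
      ∑ a ∈ l.toFinsetᶜ, if a.1 = u ∧ (P.f a).1 = v then 1 else 0 :=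
    Finset.sum_congr rfl fun a ha => by rw [h a (by simpa using ha)]
  rw [split P, split Q, hc]
  ring

/-! ### Reversing a switching -/

/-- The switching with prescribed points `1,2,3,4` whose result is `P`: the points `5,6,7,8` are
the mates in `P` of `1,2,3,4`. -/
def revSwitch (P : Pairing n d) (p1 p2 p3 p4 : Point n d) : DSwitch n d :=
  ⟨p1, p2, p3, p4, P.f p1, P.f p2, P.f p3, P.f p4⟩

/-- The pairing obtained from `P` by undoing `revSwitch P p1 p2 p3 p4`. -/
def revPairing (P : Pairing n d) (p1 p2 p3 p4 : Point n d) : Pairing n d :=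
  conj P (dtau (revSwitch P p1 p2 p3 p4)).symm

/-- The conditions on points `1,2,3,4` under which the switching that they determine can be undone
in `P`, giving a class A switching. -/
structure Reversible (P : Pairing n d) (p1 p2 p3 p4 : Point n d) : Prop where
  bin13 : p1.1 = p3.1
  bin24 : p2.1 = p4.1
  ne13 : p1 ≠ p3
  ne24 : p2 ≠ p4
  bins : [p1.1, p2.1, (P.f p1).1, (P.f p2).1, (P.f p3).1, (P.f p4).1].Pairwise (· ≠ ·)
  mult12 : mult P p1.1 p2.1 = 0
  mult56 : mult P (P.f p1).1 (P.f p2).1 = 0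
  mult78 : mult P (P.f p3).1 (P.f p4).1 = 0
  mult15 : mult P p1.1 (P.f p1).1 = 1
  mult37 : mult P p3.1 (P.f p3).1 = 1
  mult26 : mult P p2.1 (P.f p2).1 = 1
  mult48 : mult P p4.1 (P.f p4).1 = 1

theorem dResult_revPairing (P : Pairing n d) (p1 p2 p3 p4 : Point n d) :
    dResult (revPairing P p1 p2 p3 p4) (revSwitch P p1 p2 p3 p4) = P := by
  cases P
  simp [dResult, revPairing, conj]

theorem Reversible.nodup {P : Pairing n d} {p1 p2 p3 p4 : Point n d}
    (h : Reversible P p1 p2 p3 p4) :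
    [p1, p2, p3, p4, P.f p1, P.f p2, P.f p3, P.f p4].Nodup := by
  have key : ∀ {x y : Point n d}, x.1 ≠ y.1 → x ≠ y := fun h e => h (congrArg Prod.fst e)
  have hb := h.bins
  have h13 := h.bin13
  have h24 := h.bin24
  simp only [List.pairwise_cons, List.mem_cons, forall_eq_or_imp, List.not_mem_nil,
    List.nodup_cons, not_or, IsEmpty.forall_iff, implies_true, and_true, not_false_eq_true,
    List.Pairwise.nil, List.nodup_nil] at hb ⊢
  obtain ⟨⟨a1, a2, a3, a4, a5⟩, ⟨b1, b2, b3, b4⟩, ⟨c1, c2, c3⟩, ⟨d1, d2⟩, e1⟩ := hb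
  have n1 := h.ne13
  have n2 := h.ne24
  refine ⟨⟨?_, ?_, ?_, ?_, ?_, ?_, ?_⟩, ⟨?_, ?_, ?_, ?_, ?_, ?_⟩, ⟨?_, ?_, ?_, ?_, ?_⟩,
    ⟨?_, ?_, ?_, ?_⟩, ⟨?_, ?_, ?_⟩, ⟨?_, ?_⟩, ?_⟩ <;>
  first
    | assumption
    | (apply key; first | assumption | (rw [← h13]; assumption) | (rw [← h24]; assumption) |
        (rw [← h13, ← h24]; assumption) | (rw [← h13]; apply Ne.symm; assumption))

theorem Reversible.revPairing_apply {P : Pairing n d} {p1 p2 p3 p4 : Point n d}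
    (h : Reversible P p1 p2 p3 p4) :
    let Q := revPairing P p1 p2 p3 p4
    Q.f p1 = p2 ∧ Q.f p3 = p4 ∧ Q.f (P.f p1) = P.f p2 ∧ Q.f (P.f p3) = P.f p4 ∧
      ∀ x ∉ [p1, p2, p3, p4, P.f p1, P.f p2, P.f p3, P.f p4], Q.f x = P.f x := by
  have hn := h.nodup
  simp only [List.mem_cons, List.not_mem_nil, List.nodup_cons, not_or, or_false,
    not_false_eq_true, and_true, List.nodup_nil] at hn
  obtain ⟨⟨a1, a2, a3, a4, a5, a6, a7⟩, ⟨b1, b2, b3, b4, b5, b6⟩, ⟨c1, c2, c3, c4, c5⟩,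
    ⟨d1, d2, d3, d4⟩, ⟨e1, e2, e3⟩, ⟨f1, f2⟩, g1⟩ := hn
  refine ⟨?_, ?_, ?_, ?_, ?_⟩
  · simp [revPairing, revSwitch, conj, dtau, Equiv.swap_apply_def, *, Ne.symm, eq_comm]
  · simp [revPairing, revSwitch, conj, dtau, Equiv.swap_apply_def, *, Ne.symm, eq_comm]
  · simp [revPairing, revSwitch, conj, dtau, Equiv.swap_apply_def, *, Ne.symm, eq_comm]
  · simp [revPairing, revSwitch, conj, dtau, Equiv.swap_apply_def, *, Ne.symm, eq_comm]
  · intro x hx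
    simp only [List.mem_cons, List.not_mem_nil, not_or, or_false] at hx
    obtain ⟨h1, h2, h3, h4, h5, h6, h7, h8⟩ := hx
    have k : ∀ y, P.f x = y → x = P.f y := fun y hy => by rw [← hy, P.invol]
    have k2 : P.f x ≠ p2 := fun e => h6 (k _ e)
    have k4 : P.f x ≠ p4 := fun e => h8 (k _ e)
    have k5 : P.f x ≠ P.f p1 := fun e => h1 (by rw [k _ e, P.invol])
    have k7 : P.f x ≠ P.f p3 := fun e => h3 (by rw [k _ e, P.invol])
    clear k
    simp [revPairing, revSwitch, conj, dtau, Equiv.swap_apply_def, *]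

theorem Reversible.mult_revPairing {P : Pairing n d} {p1 p2 p3 p4 : Point n d}
    (h : Reversible P p1 p2 p3 p4) (u v : Fin n) :
    mult (revPairing P p1 p2 p3 p4) u v =
      if (u = p1.1 ∧ v = p2.1) ∨ (u = p2.1 ∧ v = p1.1) then 2
      else if (u = (P.f p1).1 ∧ v = (P.f p2).1) ∨ (u = (P.f p2).1 ∧ v = (P.f p1).1) ∨
          (u = (P.f p3).1 ∧ v = (P.f p4).1) ∨ (u = (P.f p4).1 ∧ v = (P.f p3).1) then 1
      else if (u = p1.1 ∧ v = (P.f p1).1) ∨ (u = (P.f p1).1 ∧ v = p1.1) ∨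
          (u = p3.1 ∧ v = (P.f p3).1) ∨ (u = (P.f p3).1 ∧ v = p3.1) ∨
          (u = p2.1 ∧ v = (P.f p2).1) ∨ (u = (P.f p2).1 ∧ v = p2.1) ∨
          (u = p4.1 ∧ v = (P.f p4).1) ∨ (u = (P.f p4).1 ∧ v = p4.1) then 0
      else mult P u v := by
  obtain ⟨q1, q3, q5, q7, qout⟩ := h.revPairing_apply
  have q2 : (revPairing P p1 p2 p3 p4).f p2 = p1 := by
    simpa only [q1] using (revPairing P p1 p2 p3 p4).invol p1
  have q4 : (revPairing P p1 p2 p3 p4).f p4 = p3 := by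
    simpa only [q3] using (revPairing P p1 p2 p3 p4).invol p3
  have q6 : (revPairing P p1 p2 p3 p4).f (P.f p2) = P.f p1 := by
    simpa only [q5] using (revPairing P p1 p2 p3 p4).invol (P.f p1)
  have q8 : (revPairing P p1 p2 p3 p4).f (P.f p4) = P.f p3 := by
    simpa only [q7] using (revPairing P p1 p2 p3 p4).invol (P.f p3)
  have key := mult_add_sum_eq P _ _ h.nodup qout u v
  have hb := h.bins
  have m1 := h.mult12
  have m2 := h.mult56
  have m3 := h.mult78
  have m4 := h.mult15
  have m5 := h.mult37
  have m6 := h.mult26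
  have m7 := h.mult48
  simp only [List.map_cons, List.map_nil, List.sum_cons, List.sum_nil, q1, q2, q3, q4, q5, q6,
    q7, q8, P.invol, ← h.bin13, ← h.bin24] at key m5 m7 ⊢
  have n1 := (mult_comm P _ _).trans m1
  have n2 := (mult_comm P _ _).trans m2
  have n3 := (mult_comm P _ _).trans m3
  have n4 := (mult_comm P _ _).trans m4
  have n5 := (mult_comm P _ _).trans m5
  have n6 := (mult_comm P _ _).trans m6
  have n7 := (mult_comm P _ _).trans m7
  clear q1 q2 q3 q4 q5 q6 q7 q8 qout
  generalize revPairing P p1 p2 p3 p4 = Q at *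
  generalize (P.f p1).1 = u2 at *
  generalize (P.f p2).1 = v2 at *
  generalize (P.f p3).1 = u3 at *
  generalize (P.f p4).1 = v3 at *
  generalize p1.1 = u1 at *
  generalize p2.1 = v1 at *
  clear h
  simp only [List.pairwise_cons, List.mem_cons, forall_eq_or_imp, List.not_mem_nil,
    IsEmpty.forall_iff, implies_true, and_true, List.Pairwise.nil] at hb
  obtain ⟨⟨a1, a2, a3, a4, a5⟩, ⟨b1, b2, b3, b4⟩, ⟨c1, c2, c3⟩, ⟨d1, d2⟩, e1⟩ := hb
  have hu : (u = u1 ∨ u = v1 ∨ u = u2 ∨ u = v2 ∨ u = u3 ∨ u = v3) ∨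
    (u1 ≠ u ∧ v1 ≠ u ∧ u2 ≠ u ∧ v2 ≠ u ∧ u3 ≠ u ∧ v3 ≠ u) := by grind
  have hv : (v = u1 ∨ v = v1 ∨ v = u2 ∨ v = v2 ∨ v = u3 ∨ v = v3) ∨
    (u1 ≠ v ∧ v1 ≠ v ∧ u2 ≠ v ∧ v2 ≠ v ∧ u3 ≠ v ∧ v3 ≠ v) := by grind
  rcases hu with hu | ⟨r1, r2, r3, r4, r5, r6⟩ <;>
    rcases hv with hv | ⟨s1, s2, s3, s4, s5, s6⟩
  · rcases hu with rfl | rfl | rfl | rfl | rfl | rfl <;>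
    rcases hv with rfl | rfl | rfl | rfl | rfl | rfl <;>
    (simp [a1, a1.symm, a2, a2.symm, a3, a3.symm, a4, a4.symm, a5, a5.symm, b1, b1.symm, b2,
      b2.symm, b3, b3.symm, b4, b4.symm, c1, c1.symm, c2, c2.symm, c3, c3.symm, d1, d1.symm,
      d2, d2.symm, e1, e1.symm, m1, m2, m3, m4, m5, m6, m7, n1, n2, n3, n4, n5, n6, n7]
        at key ⊢; omega)
  · rcases hu with rfl | rfl | rfl | rfl | rfl | rfl <;>
    (simp [a1, a1.symm, a2, a2.symm, a3, a3.symm, a4, a4.symm, a5, a5.symm, b1, b1.symm, b2,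
      b2.symm, b3, b3.symm, b4, b4.symm, c1, c1.symm, c2, c2.symm, c3, c3.symm, d1, d1.symm,
      d2, d2.symm, e1, e1.symm, s1,
      s1.symm, s2, s2.symm, s3, s3.symm, s4, s4.symm, s5, s5.symm, s6, s6.symm]
        at key ⊢; omega)
  · rcases hv with rfl | rfl | rfl | rfl | rfl | rfl <;>
    (simp [a1, a1.symm, a2, a2.symm, a3, a3.symm, a4, a4.symm, a5, a5.symm, b1, b1.symm, b2,
      b2.symm, b3, b3.symm, b4, b4.symm, c1, c1.symm, c2, c2.symm, c3, c3.symm, d1, d1.symm,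
      d2, d2.symm, e1, e1.symm, r1,
      r1.symm, r2, r2.symm, r3, r3.symm, r4, r4.symm, r5, r5.symm, r6, r6.symm]
        at key ⊢; omega)
  · simp [r1.symm, r2.symm, r3.symm, r4.symm, r5.symm, r6.symm, r1, r2, r3, r4, r5, r6]
      at key ⊢
    omega

theorem Reversible.revPairing_mem_SD {P : Pairing n d} {p1 p2 p3 p4 : Point n d}
    (h : Reversible P p1 p2 p3 p4) {i : ℕ} (hP : P ∈ SD n d i) :
    revPairing P p1 p2 p3 p4 ∈ SD n d (i + 1) := by
  obtain ⟨hl, hm, hi⟩ := hP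
  have hdiag : ∀ u : Fin n, mult P u u = 0 := fun u => by
    rw [numLoops_eq_zero_iff] at hl
    simp only [mult, Finset.card_eq_zero, Finset.filter_eq_empty_iff]
    rintro a - ⟨rfl, h2⟩
    exact hl a h2
  have hb := h.bins
  have hM := h.mult_revPairing
  have h12 := h.mult12
  rw [← h.bin13, ← h.bin24] at hM
  simp only [List.pairwise_cons, List.mem_cons, forall_eq_or_imp, List.not_mem_nil,
    IsEmpty.forall_iff, implies_true, and_true, List.Pairwise.nil] at hb
  obtain ⟨⟨a1, a2, a3, a4, a5⟩, ⟨b1, b2, b3, b4⟩, ⟨c1, c2, c3⟩, ⟨d1, d2⟩, e1⟩ := hb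
  have h2 : ∀ u v, mult (revPairing P p1 p2 p3 p4) u v = 2 ↔
      ((u = p1.1 ∧ v = p2.1) ∨ (u = p2.1 ∧ v = p1.1)) ∨ mult P u v = 2 := by
    have s12 := (mult_comm P _ _).trans h.mult12
    have s56 := (mult_comm P _ _).trans h.mult56
    have s78 := (mult_comm P _ _).trans h.mult78
    have s15 := (mult_comm P _ _).trans h.mult15
    have s37 := (mult_comm P _ _).trans h.mult37
    have s26 := (mult_comm P _ _).trans h.mult26
    have s48 := (mult_comm P _ _).trans h.mult48
    intro u v
    rw [hM]
    split_ifs with g1 g2 g3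
    · simp [g1]
    · have : mult P u v = 0 := by
        rcases g2 with ⟨rfl, rfl⟩ | ⟨rfl, rfl⟩ | ⟨rfl, rfl⟩ | ⟨rfl, rfl⟩
        exacts [h.mult56, s56, h.mult78, s78]
      simp [g1, this]
    · have : mult P u v = 1 := by
        rcases g3 with ⟨rfl, rfl⟩ | ⟨rfl, rfl⟩ | ⟨rfl, rfl⟩ | ⟨rfl, rfl⟩ | ⟨rfl, rfl⟩ | ⟨rfl, rfl⟩ |
          ⟨rfl, rfl⟩ | ⟨rfl, rfl⟩
        exacts [h.mult15, s15, h.bin13 ▸ h.mult37, h.bin13 ▸ s37, h.mult26, s26,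
          h.bin24 ▸ h.mult48, h.bin24 ▸ s48]
      simp [g1, this]
    · simp [g1]
  refine ⟨?_, ?_, ?_⟩
  · rw [numLoops_eq_zero_iff]
    intro a ha
    have h0 : mult (revPairing P p1 p2 p3 p4) a.1 a.1 = 0 := by
      rw [hM, hdiag]
      split_ifs with g1 g2
      · grind
      · grind
      · rfl
      · rfl
    have := one_le_mult (revPairing P p1 p2 p3 p4) a
    rw [ha] at this
    omega
  · intro u v huv
    rw [hM]
    have := hm u v huv
    split_ifs <;> omega
  · unfold edgesWithMult at hi ⊢
    rcases lt_or_gt_of_ne a1 with hlt | hlt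
    · rw [← hi, ← Finset.card_insert_of_notMem (a := (p1.1, p2.1)) (by simp [h12])]
      congr 1
      ext ⟨u, v⟩
      simp only [Finset.mem_filter, Finset.mem_univ, true_and, h2, Finset.mem_insert,
        Prod.mk.injEq]
      grind
    · rw [← hi, ← Finset.card_insert_of_notMem (a := (p2.1, p1.1))
        (by simp [mult_comm P p2.1, h12])]
      congr 1
      ext ⟨u, v⟩
      simp only [Finset.mem_filter, Finset.mem_univ, true_and, h2, Finset.mem_insert,
        Prod.mk.injEq]
      grind

theorem Reversible.isTypeIA {P : Pairing n d} {p1 p2 p3 p4 : Point n d}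
    (h : Reversible P p1 p2 p3 p4) :
    IsTypeIA (revPairing P p1 p2 p3 p4) (revSwitch P p1 p2 p3 p4) := by
  obtain ⟨q1, q3, q5, q7, -⟩ := h.revPairing_apply
  have hM := h.mult_revPairing
  have hb := h.bins
  have hb' := h.bins
  have h13 := h.bin13
  have h24 := h.bin24
  simp only [List.pairwise_cons, List.mem_cons, forall_eq_or_imp, List.not_mem_nil,
    IsEmpty.forall_iff, implies_true, and_true, List.Pairwise.nil] at hb
  obtain ⟨⟨a1, a2, a3, a4, a5⟩, ⟨b1, b2, b3, b4⟩, ⟨c1, c2, c3⟩, ⟨d1, d2⟩, e1⟩ := hb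
  have z : ∀ t ∈ targets (revSwitch P p1 p2 p3 p4),
      mult (revPairing P p1 p2 p3 p4) t.1 t.2 = 0 := by
    simp only [targets, revSwitch, List.mem_cons, List.not_mem_nil, or_false, forall_eq_or_imp,
      forall_eq]
    refine ⟨?_, ?_, ?_, ?_⟩ <;> rw [hM] <;> grind
  have hc : joinedCount (revPairing P p1 p2 p3 p4) (revSwitch P p1 p2 p3 p4) = 0 := by
    rw [joinedCount, List.countP_eq_zero]
    intro t ht
    simp [z t ht]
  refine ⟨⟨⟨q1, q3, q5, q7, h13, h24, h.ne13, ?_, ?_, ?_, hb'⟩, ?_, hc.le.trans zero_le_one⟩, hc⟩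
  · simp [revSwitch, hM]
  · simp only [revSwitch, hM]; grind
  · simp only [revSwitch, hM]; grind
  · intro t ht
    simp [z t ht]

/-! ### Counting -/

/-- The points of the bin `u`. -/
def binPoints (d : ℕ) (u : Fin n) : Finset (Point n d) :=
  Finset.univ.filter fun a => a.1 = u

theorem card_binPoints (u : Fin n) : (binPoints d u).card = d := by
  have : binPoints d u = ({u} : Finset (Fin n)) ×ˢ (Finset.univ : Finset (Fin d)) := by
    ext ⟨a, b⟩
    simp [binPoints, eq_comm]
  simp [this]

theorem mem_binPoints {u : Fin n} {a : Point n d} : a ∈ binPoints d u ↔ a.1 = u := by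
  simp [binPoints]

/-- Ordered pairs of distinct points in a common bin. -/
def wedges (n d : ℕ) : Finset (Point n d × Point n d) :=
  Finset.univ.filter fun w => w.1.1 = w.2.1 ∧ w.1 ≠ w.2

theorem mem_wedges {w : Point n d × Point n d} :
    w ∈ wedges n d ↔ w.1.1 = w.2.1 ∧ w.1 ≠ w.2 := by
  simp [wedges]

theorem card_wedges_filter_fst (X : Finset (Point n d)) :
    ((wedges n d).filter fun w => w.1 ∈ X).card = X.card * (d - 1) := by
  have hmaps : Set.MapsTo Prod.fst (SetLike.coe ((wedges n d).filter fun w => w.1 ∈ X))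
      (SetLike.coe X) := fun w hw => (Finset.mem_filter.mp (Finset.mem_coe.mp hw)).2
  rw [Finset.card_eq_sum_card_fiberwise hmaps, ← smul_eq_mul, ← Finset.sum_const]
  refine Finset.sum_congr rfl fun a ha => ?_
  have h : (((wedges n d).filter fun w => w.1 ∈ X).filter fun w => w.1 = a) =
      ((binPoints d a.1).erase a).map ⟨Prod.mk a, Prod.mk_right_injective a⟩ := by
    ext ⟨x, y⟩
    simp only [Finset.mem_filter, mem_wedges, Finset.mem_map, Finset.mem_erase, mem_binPoints,
      Function.Embedding.coeFn_mk, Prod.mk.injEq]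
    constructor
    · rintro ⟨⟨⟨h1, h2⟩, -⟩, rfl⟩
      exact ⟨y, ⟨h2.symm, h1.symm⟩, rfl, rfl⟩
    · rintro ⟨y, ⟨h1, h2⟩, rfl, rfl⟩
      exact ⟨⟨⟨h2.symm, h1.symm⟩, ha⟩, rfl⟩
  rw [h, Finset.card_map, Finset.card_erase_of_mem (mem_binPoints.mpr rfl), card_binPoints]

theorem card_wedges_filter_snd (X : Finset (Point n d)) :
    ((wedges n d).filter fun w => w.2 ∈ X).card = X.card * (d - 1) := by
  rw [← card_wedges_filter_fst]
  refine Finset.card_bij' (fun w _ => w.swap) (fun w _ => w.swap) ?_ ?_ ?_ ?_ <;>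
    simp +contextual [mem_wedges, eq_comm]

theorem card_wedges : (wedges n d).card = n * d * (d - 1) := by
  simpa using card_wedges_filter_fst (Finset.univ : Finset (Point n d))

theorem card_wedges_filter_or_le (X Y : Finset (Point n d)) :
    ((wedges n d).filter fun w => w.1 ∈ X ∨ w.2 ∈ Y).card ≤ (X.card + Y.card) * (d - 1) := by
  rw [Finset.filter_or, add_mul, ← card_wedges_filter_fst, ← card_wedges_filter_snd]
  exact Finset.card_union_le _ _

/-- The points belonging to a pair of a double edge. -/
def doublePoints (P : Pairing n d) : Finset (Point n d) :=
  Finset.univ.filter fun a => mult P a.1 (P.f a).1 = 2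

theorem card_doublePoints_le {P : Pairing n d} {i : ℕ} (hP : P ∈ SD n d i) :
    (doublePoints P).card ≤ 4 * i := by
  obtain ⟨hl, -, rfl⟩ := hP
  rw [numLoops_eq_zero_iff] at hl
  let E := Finset.univ.filter fun q : Fin n × Fin n => q.1 < q.2 ∧ mult P q.1 q.2 = 2
  let F : Fin n × Fin n → Finset (Point n d) := fun q =>
    (Finset.univ.filter fun a => a.1 = q.1 ∧ (P.f a).1 = q.2) ∪
      Finset.univ.filter fun a => a.1 = q.2 ∧ (P.f a).1 = q.1
  have hsub : doublePoints P ⊆ E.biUnion F := by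
    intro a ha
    have ha : mult P a.1 (P.f a).1 = 2 := by simpa [doublePoints] using ha
    rw [Finset.mem_biUnion]
    rcases lt_or_gt_of_ne (hl a) with hlt | hlt
    · exact ⟨((P.f a).1, a.1), by simp [E, hlt, mult_comm P (P.f a).1, ha], by simp [F]⟩
    · exact ⟨(a.1, (P.f a).1), by simp [E, hlt, ha], by simp [F]⟩
  have hcard : ∀ q ∈ E, (F q).card ≤ 4 := by
    intro q hq
    have hq : mult P q.1 q.2 = 2 := by simp only [E, Finset.mem_filter] at hq; exact hq.2.2
    have hq' := (mult_comm P _ _).trans hq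
    have := Finset.card_union_le (Finset.univ.filter fun a => a.1 = q.1 ∧ (P.f a).1 = q.2)
      (Finset.univ.filter fun a => a.1 = q.2 ∧ (P.f a).1 = q.1)
    unfold mult at hq hq'
    simp only [F]
    omega
  calc _ ≤ _ := Finset.card_le_card hsub
    _ ≤ E.card * 4 := Finset.card_biUnion_le_card_mul _ _ _ hcard
    _ = 4 * edgesWithMult P 2 := mul_comm _ _

/-- The points whose bin is `u` or is joined to `u`. -/
def closedNbhdPoints (P : Pairing n d) (u : Fin n) : Finset (Point n d) :=
  Finset.univ.filter fun p => p.1 = u ∨ 1 ≤ mult P u p.1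

theorem card_closedNbhdPoints_le (P : Pairing n d) (u : Fin n) :
    (closedNbhdPoints P u).card ≤ d + d * d := by
  have hsub : closedNbhdPoints P u ⊆
      binPoints d u ∪ (binPoints d u).biUnion fun a => binPoints d (P.f a).1 := by
    intro p hp
    simp only [closedNbhdPoints, Finset.mem_filter, Finset.mem_univ, true_and] at hp
    simp only [Finset.mem_union, Finset.mem_biUnion, mem_binPoints]
    refine hp.imp_right fun h => ?_
    obtain ⟨a, ha⟩ := Finset.card_pos.mp h
    simp only [Finset.mem_filter, Finset.mem_univ, true_and] at ha
    exact ⟨a, ha.1, ha.2.symm⟩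
  refine (Finset.card_le_card hsub).trans <| (Finset.card_union_le _ _).trans ?_
  refine add_le_add (card_binPoints u).le ?_
  have := Finset.card_biUnion_le_card_mul (binPoints d u) (fun a => binPoints d (P.f a).1) d
    fun a _ => (card_binPoints _).le
  rwa [card_binPoints] at this

/-- The points whose mate lies in the bin `u`. -/
def matesIn (P : Pairing n d) (u : Fin n) : Finset (Point n d) :=
  Finset.univ.filter fun p => (P.f p).1 = u

theorem card_matesIn (P : Pairing n d) (u : Fin n) : (matesIn P u).card = d := by
  refine Eq.trans ?_ (card_binPoints u)
  refine Finset.card_bij' (fun a _ => P.f a) (fun a _ => P.f a) ?_ ?_ ?_ ?_ <;>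
    simp +contextual [matesIn, mem_binPoints, P.invol]

/-- The points outside the bin of `c` whose mate lies in a bin joined to the bin of `c` but
different from the bin of the mate of `c`. -/
def matesNear (P : Pairing n d) (c : Point n d) : Finset (Point n d) :=
  Finset.univ.filter fun p => 1 ≤ mult P c.1 (P.f p).1 ∧ (P.f p).1 ≠ (P.f c).1 ∧ p.1 ≠ c.1

theorem card_matesNear_le (P : Pairing n d) (c : Point n d) :
    (matesNear P c).card ≤ (d - 1) * (d - 1) := by
  have hsub : (matesNear P c).image P.f ⊆ ((binPoints d c.1).erase c).biUnion fun a =>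
      (binPoints d (P.f a).1).erase (P.f a) := by
    intro x hx
    obtain ⟨p, hp, rfl⟩ := Finset.mem_image.mp hx
    simp only [matesNear, Finset.mem_filter, Finset.mem_univ, true_and] at hp
    obtain ⟨h1, h2, h3⟩ := hp
    obtain ⟨a, ha⟩ := Finset.card_pos.mp h1
    simp only [Finset.mem_filter, Finset.mem_univ, true_and] at ha
    simp only [Finset.mem_biUnion, Finset.mem_erase, mem_binPoints]
    refine ⟨a, ⟨?_, ha.1⟩, ?_, ha.2.symm⟩
    · rintro rfl
      exact h2 ha.2.symm
    · intro e
      have : p = a := by rw [← P.invol p, e, P.invol]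
      exact h3 (this ▸ ha.1)
  have hinj : Function.Injective P.f := fun x y h => by rw [← P.invol x, h, P.invol]
  rw [← Finset.card_image_of_injective _ hinj]
  have := Finset.card_biUnion_le_card_mul ((binPoints d c.1).erase c)
    (fun a => (binPoints d (P.f a).1).erase (P.f a)) (d - 1) fun a _ => by
      rw [Finset.card_erase_of_mem (mem_binPoints.mpr rfl), card_binPoints]
  rw [Finset.card_erase_of_mem (mem_binPoints.mpr rfl), card_binPoints] at this
  exact (Finset.card_le_card hsub).trans this

/-- The forbidden choices of the point 2, given the points 1 and 3. -/
def forbiddenTwo (P : Pairing n d) (p1 p3 : Point n d) : Finset (Point n d) :=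
  closedNbhdPoints P p1.1 ∪ matesIn P (P.f p1).1 ∪ matesIn P (P.f p3).1 ∪ matesNear P (P.f p1)

/-- The forbidden choices of the point 4, given the points 1 and 3. -/
def forbiddenFour (P : Pairing n d) (p1 p3 : Point n d) : Finset (Point n d) :=
  matesIn P (P.f p1).1 ∪ matesIn P (P.f p3).1 ∪ matesNear P (P.f p3)

theorem card_forbiddenTwo_le (P : Pairing n d) (p1 p3 : Point n d) :
    (forbiddenTwo P p1 p3).card ≤ d + d * d + d + d + (d - 1) * (d - 1) := by
  unfold forbiddenTwo
  grw [Finset.card_union_le, Finset.card_union_le, Finset.card_union_le,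
    card_closedNbhdPoints_le, card_matesIn, card_matesIn, card_matesNear_le]

theorem card_forbiddenFour_le (P : Pairing n d) (p1 p3 : Point n d) :
    (forbiddenFour P p1 p3).card ≤ d + d + (d - 1) * (d - 1) := by
  unfold forbiddenFour
  grw [Finset.card_union_le, Finset.card_union_le, card_matesIn, card_matesIn,
    card_matesNear_le]

theorem mult_eq_one_of_notMem_doublePoints {P : Pairing n d} {i : ℕ} (hP : P ∈ SD n d i)
    {a : Point n d} (ha : a ∉ doublePoints P) : mult P a.1 (P.f a).1 = 1 := by
  have h1 := one_le_mult P a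
  have h2 := hP.2.1 _ _ ((numLoops_eq_zero_iff P).mp hP.1 a).symm
  have h3 : mult P a.1 (P.f a).1 ≠ 2 := by simpa [doublePoints] using ha
  omega

theorem reversible_of_notMem {P : Pairing n d} {i : ℕ} (hP : P ∈ SD n d i)
    {p1 p2 p3 p4 : Point n d} (bin13 : p1.1 = p3.1) (bin24 : p2.1 = p4.1) (ne13 : p1 ≠ p3)
    (ne24 : p2 ≠ p4) (h1 : p1 ∉ doublePoints P) (h3 : p3 ∉ doublePoints P)
    (h2 : p2 ∉ doublePoints P ∪ forbiddenTwo P p1 p3)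
    (h4 : p4 ∉ doublePoints P ∪ forbiddenFour P p1 p3) : Reversible P p1 p2 p3 p4 := by
  have hloop := (numLoops_eq_zero_iff P).mp hP.1
  simp only [forbiddenTwo, forbiddenFour, Finset.mem_union, not_or] at h2 h4
  obtain ⟨h2, ⟨⟨hN, hA⟩, hB⟩, hC⟩ := h2
  obtain ⟨h4, ⟨hA', hB'⟩, hC'⟩ := h4
  have m1 := mult_eq_one_of_notMem_doublePoints hP h1
  have m2 := mult_eq_one_of_notMem_doublePoints hP h2
  have m3 := mult_eq_one_of_notMem_doublePoints hP h3
  have m4 := mult_eq_one_of_notMem_doublePoints hP h4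
  simp only [closedNbhdPoints, matesIn, matesNear, P.invol, Finset.mem_filter, Finset.mem_univ,
    true_and, not_or, not_le, Nat.lt_one_iff] at hN hA hB hC hA' hB' hC'
  obtain ⟨hN, m12⟩ := hN
  have m21 := (mult_comm P p2.1 p1.1).trans m12
  have e1 := hloop p1
  have e2 := hloop p2
  have e3 := hloop p3
  have e4 := hloop p4
  have n57 : (P.f p1).1 ≠ (P.f p3).1 := fun h => by
    have := two_le_mult P ne13 bin13 h
    omega
  have n68 : (P.f p2).1 ≠ (P.f p4).1 := fun h => by
    have := two_le_mult P ne24 bin24 h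
    omega
  rw [← bin13] at m3 e3
  rw [← bin24] at m4 e4
  have n25 : p2.1 ≠ (P.f p1).1 := fun h => by rw [← h] at m1; omega
  have n27 : p2.1 ≠ (P.f p3).1 := fun h => by rw [← h] at m3; omega
  have n16 : p1.1 ≠ (P.f p2).1 := fun h => by rw [← h] at m2; omega
  have n18 : p1.1 ≠ (P.f p4).1 := fun h => by rw [← h] at m4; omega
  refine ⟨bin13, bin24, ne13, ne24, ?_, m12, ?_, ?_, m1, bin13 ▸ m3, m2, bin24 ▸ m4⟩
  · simp only [List.pairwise_cons, List.mem_cons, List.not_mem_nil]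
    grind
  · by_contra h
    exact hC ⟨by omega, n16.symm, n25⟩
  · by_contra h
    exact hC' ⟨by omega, fun e => n18 (bin13.trans e.symm), fun e => n27 (bin24.trans e)⟩

open Classical in
/-- The choices of the points `((1, 3), (2, 4))` whose inverse d-switching is valid. -/
noncomputable def reversibleQuads (P : Pairing n d) :
    Finset ((Point n d × Point n d) × (Point n d × Point n d)) :=
  (wedges n d ×ˢ wedges n d).filter fun q => Reversible P q.1.1 q.2.1 q.1.2 q.2.2

theorem mem_reversibleQuads {P : Pairing n d}
    {q : (Point n d × Point n d) × (Point n d × Point n d)} :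
    q ∈ reversibleQuads P ↔
      q ∈ wedges n d ×ˢ wedges n d ∧ Reversible P q.1.1 q.2.1 q.1.2 q.2.2 := by
  classical
  exact Finset.mem_filter

theorem card_wedges_sq_le {P : Pairing n d} {i : ℕ} (hP : P ∈ SD n d i) (hd : 0 < d) :
    (n * d * (d - 1)) ^ 2 ≤ (reversibleQuads P).card +
      n * d * (d - 1) * (d - 1) * (16 * i + 3 * d ^ 2 + d + 2) := by
  classical
  let D := doublePoints P
  let B₁ := (wedges n d).filter fun w => w.1 ∈ D ∨ w.2 ∈ D
  let B₂ := fun w : Point n d × Point n d => (wedges n d).filter fun w' =>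
    w'.1 ∈ D ∪ forbiddenTwo P w.1 w.2 ∨ w'.2 ∈ D ∪ forbiddenFour P w.1 w.2
  have hD : D.card ≤ 4 * i := card_doublePoints_le hP
  have hB₁ : B₁.card ≤ 8 * i * (d - 1) := by
    refine (card_wedges_filter_or_le D D).trans (Nat.mul_le_mul_right _ ?_)
    omega
  have hB₂ : ∀ w, (B₂ w).card ≤ (8 * i + 3 * d ^ 2 + d + 2) * (d - 1) := by
    intro w
    refine (card_wedges_filter_or_le _ _).trans (Nat.mul_le_mul_right _ ?_)
    grw [Finset.card_union_le, Finset.card_union_le, hD, card_forbiddenTwo_le,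
      card_forbiddenFour_le]
    obtain ⟨e, rfl⟩ : ∃ e, d = e + 1 := ⟨d - 1, by omega⟩
    simp only [Nat.add_sub_cancel]
    apply le_of_eq
    ring
  have hcover : wedges n d ×ˢ wedges n d ⊆ reversibleQuads P ∪
      (B₁ ×ˢ wedges n d ∪ (wedges n d).biUnion fun w => (B₂ w).image (Prod.mk w)) := by
    rintro ⟨⟨p1, p3⟩, ⟨p2, p4⟩⟩ hq
    have hq' := Finset.mem_product.mp hq
    by_contra hbad
    simp only [Finset.mem_union, not_or] at hbad
    obtain ⟨hr, hb1, hb2⟩ := hbad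
    have hb1 : ¬ (p1 ∈ D ∨ p3 ∈ D) := fun h =>
      hb1 (Finset.mem_product.mpr ⟨Finset.mem_filter.mpr ⟨hq'.1, h⟩, hq'.2⟩)
    have hb2 : ¬ (p2 ∈ D ∪ forbiddenTwo P p1 p3 ∨ p4 ∈ D ∪ forbiddenFour P p1 p3) := fun h =>
      hb2 (Finset.mem_biUnion.mpr ⟨_, hq'.1,
        Finset.mem_image_of_mem _ (Finset.mem_filter.mpr ⟨hq'.2, h⟩)⟩)
    rw [not_or] at hb1 hb2
    obtain ⟨hw, hw'⟩ := hq'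
    rw [mem_wedges] at hw hw'
    exact hr (mem_reversibleQuads.mpr ⟨hq,
      reversible_of_notMem hP hw.1 hw'.1 hw.2 hw'.2 hb1.1 hb1.2 hb2.1 hb2.2⟩)
  have hbi : ((wedges n d).biUnion fun w => (B₂ w).image (Prod.mk w)).card ≤
      n * d * (d - 1) * ((8 * i + 3 * d ^ 2 + d + 2) * (d - 1)) := by
    rw [← card_wedges]
    exact Finset.card_biUnion_le_card_mul _ _ _ fun w _ => Finset.card_image_le.trans (hB₂ w)
  have := Finset.card_le_card hcover
  grw [Finset.card_union_le, Finset.card_union_le, hbi, Finset.card_product,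
    Finset.card_product, hB₁, card_wedges] at this
  linarith

/-- For every `0 ≤ i ≤ i1 - 1` and every pairing `P ∈ S_i`, the number of class A
switchings producing `P` satisfies `b_A(P) ≥ M2² - M2 (d-1) (16 i + 3 d² + d + 6)`. -/
theorem stmt_2 (n d : ℕ) (hn : 0 < n) (hd : 0 < d) (he : Even (d * n))
    (γ : ℝ) (hγ : 0 < γ) (i : ℕ) (hi : i + 1 ≤ i1Nat d γ)
    (P : Pairing n d) (hP : P ∈ SD n d i) :
    M2R n d ^ 2 - M2R n d * ((d : ℝ) - 1) * (16 * i + 3 * (d : ℝ) ^ 2 + d + 6)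
      ≤ (bA (i1Nat d γ) P : ℝ) := by
  have hle : (reversibleQuads P).card ≤ bA (i1Nat d γ) P := by
    rw [← Nat.card_eq_finsetCard]
    have hrev : ∀ q : reversibleQuads P, Reversible P q.1.1.1 q.1.2.1 q.1.1.2 q.1.2.2 :=
      fun q => (mem_reversibleQuads.mp q.2).2
    refine Nat.card_le_card_of_injective (fun q => ⟨(revPairing P q.1.1.1 q.1.2.1 q.1.1.2 q.1.2.2,
      revSwitch P q.1.1.1 q.1.2.1 q.1.1.2 q.1.2.2),
      ⟨i + 1, hi, (hrev q).revPairing_mem_SD hP⟩, (hrev q).isTypeIA,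
      dResult_revPairing P _ _ _ _⟩) ?_
    rintro ⟨⟨⟨p1, p3⟩, ⟨p2, p4⟩⟩, hq⟩ ⟨⟨⟨r1, r3⟩, ⟨r2, r4⟩⟩, hr⟩ h
    have h := congrArg (fun x => x.1.2) h
    simp only [revSwitch, DSwitch.mk.injEq] at h
    obtain ⟨rfl, rfl, rfl, rfl, -⟩ := h
    rfl
  have hcount : ((n * d * (d - 1) : ℕ) : ℝ) ^ 2 ≤ (bA (i1Nat d γ) P : ℝ) +
      (n * d * (d - 1) : ℕ) * ((d - 1 : ℕ) : ℝ) * (16 * i + 3 * (d : ℝ) ^ 2 + d + 2) := by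
    exact_mod_cast (card_wedges_sq_le hP hd).trans (Nat.add_le_add_right hle _)
  have hM : ((n * d * (d - 1) : ℕ) : ℝ) = M2R n d := by
    rw [M2R, Nat.cast_mul, Nat.cast_mul, Nat.cast_pred hd]
  have hnonneg : (0 : ℝ) ≤ (n * d * (d - 1) : ℕ) * ((d - 1 : ℕ) : ℝ) := by positivity
  rw [hM, Nat.cast_pred hd] at hcount hnonneg
  nlinarith

end Reg
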